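/- Let A be a nonzero m×n real matrix, and let i, j be row indices such that min_k a_{ik} ≥ α · max_k a_{jk} for some α > 1. Then for every θ > 1/(α − 1) and every optimal solution X of the problem: maximize ⟨A,X⟩ subject to ‖X‖_θ ≤ 1, which has the form X = σ·u·vᵀ with σ > 0, ‖u‖₂ = ‖v‖₂ = 1, u ≥ 0, v ≥ 0 (an entrywise nonnegative rank-one solution), the j-th row of X is zero. -/

import Mathlib

open scoped BigOperators

noncomputable section

namespace LAROS

variable {m n : ℕ}

/-- Trace inner product `⟨A,X⟩ = trace(Aᵀ X)`. -/
def mInner (A X : Matrix (Fin m) (Fin n) ℝ) : ℝ := ∑ i, ∑ j, A i j * X i j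

/-- `N` is a norm on `m×n` real matrices. -/
def IsMatrixNorm (N : Matrix (Fin m) (Fin n) ℝ → ℝ) : Prop :=
  (∀ X, N X = 0 ↔ X = 0) ∧ (∀ (c : ℝ) (X), N (c • X) = |c| * N X) ∧
    (∀ X Y, N (X + Y) ≤ N X + N Y)

/-- Dual norm of `N`. -/
def dualNorm (N : Matrix (Fin m) (Fin n) ℝ → ℝ) (A : Matrix (Fin m) (Fin n) ℝ) : ℝ :=
  sSup {r | ∃ Y, N Y ≤ 1 ∧ r = mInner A Y}

/-- `X` is optimal for: minimize `N X` subject to `⟨A,X⟩ ≥ 1`. -/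
def IsOptMin (N : Matrix (Fin m) (Fin n) ℝ → ℝ) (A X : Matrix (Fin m) (Fin n) ℝ) : Prop :=
  1 ≤ mInner A X ∧ ∀ X', 1 ≤ mInner A X' → N X ≤ N X'

/-- `Y` is optimal for: maximize `⟨A,Y⟩` subject to `N Y ≤ 1`. -/
def IsOptMax (N : Matrix (Fin m) (Fin n) ℝ → ℝ) (A Y : Matrix (Fin m) (Fin n) ℝ) : Prop :=
  N Y ≤ 1 ∧ ∀ Y', N Y' ≤ 1 → mInner A Y' ≤ mInner A Y

/-- Subdifferential of `f : ℝ^{m×n} → ℝ` at `A`, with respect to the trace inner product. -/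
def subdiff (f : Matrix (Fin m) (Fin n) ℝ → ℝ) (A : Matrix (Fin m) (Fin n) ℝ) :
    Set (Matrix (Fin m) (Fin n) ℝ) :=
  {Y | ∀ B, f A + mInner (B - A) Y ≤ f B}

/-- The spectral norm (largest singular value) of an `m×n` real matrix. -/
def spectralNorm (A : Matrix (Fin m) (Fin n) ℝ) : ℝ :=
  sSup {r | ∃ (u : Fin m → ℝ) (v : Fin n → ℝ),
    (∑ i, u i ^ 2) ≤ 1 ∧ (∑ j, v j ^ 2) ≤ 1 ∧ r = ∑ i, ∑ j, u i * A i j * v j}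

/-- The nuclear norm (sum of singular values), as the dual norm of the spectral norm. -/
def nuclearNorm (A : Matrix (Fin m) (Fin n) ℝ) : ℝ := dualNorm spectralNorm A

/-- Entrywise ℓ1 norm: sum of absolute values of all entries. -/
def l1Norm (X : Matrix (Fin m) (Fin n) ℝ) : ℝ := ∑ i, ∑ j, |X i j|

/-- Entrywise max norm: maximum absolute value of an entry. -/
def maxNorm (X : Matrix (Fin m) (Fin n) ℝ) : ℝ := sSup {r | ∃ i j, r = |X i j|}

/-- The norm `‖X‖_θ = ‖X‖_* + θ‖X‖₁`. -/
def thetaNorm (θ : ℝ) (X : Matrix (Fin m) (Fin n) ℝ) : ℝ := nuclearNorm X + θ * l1Norm X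

theorem bilinear_le_l1Norm (Y : Matrix (Fin m) (Fin n) ℝ) {u : Fin m → ℝ} {v : Fin n → ℝ}
    (hu : ∑ i, u i ^ 2 ≤ 1) (hv : ∑ j, v j ^ 2 ≤ 1) :
    ∑ i, ∑ j, u i * Y i j * v j ≤ l1Norm Y := by
  have hu1 : ∀ i, |u i| ≤ 1 := fun i => (sq_le_one_iff_abs_le_one _).1 <|
    (Finset.single_le_sum (f := fun i => u i ^ 2) (fun _ _ => sq_nonneg _)
      (Finset.mem_univ i)).trans hu
  have hv1 : ∀ j, |v j| ≤ 1 := fun j => (sq_le_one_iff_abs_le_one _).1 <|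
    (Finset.single_le_sum (f := fun j => v j ^ 2) (fun _ _ => sq_nonneg _)
      (Finset.mem_univ j)).trans hv
  refine Finset.sum_le_sum fun i _ => Finset.sum_le_sum fun j _ => (le_abs_self _).trans ?_
  rw [abs_mul, abs_mul]
  calc |u i| * |Y i j| * |v j| ≤ 1 * |Y i j| * 1 := by
        gcongr
        exacts [hu1 i, hv1 j]
    _ = |Y i j| := by ring

theorem bilinear_le_spectralNorm (Y : Matrix (Fin m) (Fin n) ℝ) {u : Fin m → ℝ} {v : Fin n → ℝ}
    (hu : ∑ i, u i ^ 2 ≤ 1) (hv : ∑ j, v j ^ 2 ≤ 1) :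
    ∑ i, ∑ j, u i * Y i j * v j ≤ spectralNorm Y := by
  refine le_csSup ⟨l1Norm Y, ?_⟩ ⟨u, v, hu, hv, rfl⟩
  rintro _ ⟨u, v, hu, hv, rfl⟩
  exact bilinear_le_l1Norm Y hu hv

theorem abs_entry_le_spectralNorm (Y : Matrix (Fin m) (Fin n) ℝ) (i : Fin m) (j : Fin n) :
    |Y i j| ≤ spectralNorm Y := by
  have key : ∀ s : ℝ, s ^ 2 ≤ 1 → s * Y i j ≤ spectralNorm Y := fun s hs => by
    have h := bilinear_le_spectralNorm Y (u := Pi.single i s) (v := Pi.single j 1)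
      (by simpa [Pi.single_apply, ite_pow] using hs) (by simp [Pi.single_apply, ite_pow])
    simpa [Pi.single_apply] using h
  rw [abs_le']
  exact ⟨by simpa using key 1 (by norm_num), by simpa using key (-1) (by norm_num)⟩

theorem mInner_le_l1Norm (X : Matrix (Fin m) (Fin n) ℝ) {Y : Matrix (Fin m) (Fin n) ℝ}
    (hY : spectralNorm Y ≤ 1) : mInner X Y ≤ l1Norm X := by
  refine Finset.sum_le_sum fun i _ => Finset.sum_le_sum fun j _ => (le_abs_self _).trans ?_
  rw [abs_mul]
  exact mul_le_of_le_one_right (abs_nonneg _) ((abs_entry_le_spectralNorm Y i j).trans hY)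

theorem l1Norm_nonneg (X : Matrix (Fin m) (Fin n) ℝ) : 0 ≤ l1Norm X :=
  Finset.sum_nonneg fun _ _ => Finset.sum_nonneg fun _ _ => abs_nonneg _

theorem nuclearNorm_le_l1Norm (X : Matrix (Fin m) (Fin n) ℝ) : nuclearNorm X ≤ l1Norm X := by
  refine Real.sSup_le ?_ (l1Norm_nonneg X)
  rintro _ ⟨Y, hY, rfl⟩
  exact mInner_le_l1Norm X hY

theorem mInner_le_nuclearNorm (X : Matrix (Fin m) (Fin n) ℝ) {Y : Matrix (Fin m) (Fin n) ℝ}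
    (hY : spectralNorm Y ≤ 1) : mInner X Y ≤ nuclearNorm X := by
  refine le_csSup ⟨l1Norm X, ?_⟩ ⟨Y, hY, rfl⟩
  rintro _ ⟨Y, hY, rfl⟩
  exact mInner_le_l1Norm X hY

theorem spectralNorm_vecMulVec_le_one {u : Fin m → ℝ} {v : Fin n → ℝ}
    (hu : ∑ i, u i ^ 2 ≤ 1) (hv : ∑ j, v j ^ 2 ≤ 1) :
    spectralNorm (Matrix.vecMulVec u v) ≤ 1 := by
  refine Real.sSup_le ?_ zero_le_one
  rintro _ ⟨a, b, ha, hb, rfl⟩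
  have hau : |∑ i, a i * u i| ≤ 1 := (sq_le_one_iff_abs_le_one _).1 <|
    (Finset.sum_mul_sq_le_sq_mul_sq _ a u).trans <|
      mul_le_one₀ ha (Finset.sum_nonneg fun _ _ => sq_nonneg _) hu
  have hvb : |∑ j, v j * b j| ≤ 1 := (sq_le_one_iff_abs_le_one _).1 <|
    (Finset.sum_mul_sq_le_sq_mul_sq _ v b).trans <|
      mul_le_one₀ hv (Finset.sum_nonneg fun _ _ => sq_nonneg _) hb
  calc ∑ i, ∑ j, a i * Matrix.vecMulVec u v i j * b j
      = (∑ i, a i * u i) * ∑ j, v j * b j := by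
        rw [Finset.sum_mul_sum]
        simp only [Matrix.vecMulVec_apply]
        exact Finset.sum_congr rfl fun i _ => Finset.sum_congr rfl fun j _ => by ring
    _ ≤ |(∑ i, a i * u i) * ∑ j, v j * b j| := le_abs_self _
    _ ≤ 1 := by
        rw [abs_mul]
        exact mul_le_one₀ hau (abs_nonneg _) hvb

theorem mInner_smul_vecMulVec (A : Matrix (Fin m) (Fin n) ℝ) (c : ℝ) (u : Fin m → ℝ)
    (v : Fin n → ℝ) :
    mInner A (c • Matrix.vecMulVec u v) = c * ∑ i, u i * ∑ j, A i j * v j := by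
  simp only [mInner, Matrix.smul_apply, Matrix.vecMulVec_apply, smul_eq_mul, Finset.mul_sum]
  exact Finset.sum_congr rfl fun i _ => Finset.sum_congr rfl fun j _ => by ring

theorem l1Norm_smul_vecMulVec {c : ℝ} (hc : 0 ≤ c) {u : Fin m → ℝ} {v : Fin n → ℝ}
    (hu : ∀ i, 0 ≤ u i) (hv : ∀ j, 0 ≤ v j) :
    l1Norm (c • Matrix.vecMulVec u v) = c * ((∑ i, u i) * ∑ j, v j) := by
  rw [Finset.sum_mul_sum]
  simp only [l1Norm, Matrix.smul_apply, Matrix.vecMulVec_apply, smul_eq_mul, Finset.mul_sum]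
  exact Finset.sum_congr rfl fun i _ => Finset.sum_congr rfl fun j _ =>
    abs_of_nonneg (mul_nonneg hc (mul_nonneg (hu i) (hv j)))

theorem nuclearNorm_smul_vecMulVec_le {c : ℝ} (hc : 0 ≤ c) (u : Fin m → ℝ) {v : Fin n → ℝ}
    (hv : ∑ j, v j ^ 2 ≤ 1) :
    nuclearNorm (c • Matrix.vecMulVec u v) ≤ c * √(∑ i, u i ^ 2) := by
  refine Real.sSup_le ?_ (by positivity)
  rintro _ ⟨Y, hY, rfl⟩
  set r := √(∑ i, u i ^ 2)
  have hsq : r ^ 2 = ∑ i, u i ^ 2 := Real.sq_sqrt (Finset.sum_nonneg fun _ _ => sq_nonneg _)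
  have hur : ∀ i, u i = r * (u i / r) := fun i => by
    rcases eq_or_ne r 0 with h0 | h0
    · have : ∑ i, u i ^ 2 = 0 := by rw [← hsq, h0]; norm_num
      have := (Finset.sum_eq_zero_iff_of_nonneg fun _ _ => sq_nonneg _).1 this i
        (Finset.mem_univ i)
      simpa [h0] using this
    · field_simp
  have hw : ∑ i, (u i / r) ^ 2 ≤ 1 := by
    simp only [div_pow]
    rw [← Finset.sum_div, ← hsq]
    exact div_self_le_one _
  have h := (bilinear_le_spectralNorm Y hw hv).trans hY
  calc mInner (c • Matrix.vecMulVec u v) Y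
      = c * (r * ∑ i, ∑ j, u i / r * Y i j * v j) := by
        simp only [mInner, Matrix.smul_apply, Matrix.vecMulVec_apply, smul_eq_mul, Finset.mul_sum]
        refine Finset.sum_congr rfl fun i _ => Finset.sum_congr rfl fun j _ => ?_
        linear_combination c * v j * Y i j * hur i
    _ ≤ c * r := mul_le_mul_of_nonneg_left
        (mul_le_of_le_one_right (Real.sqrt_nonneg _) h) hc

theorem le_nuclearNorm_smul_vecMulVec (c : ℝ) {u : Fin m → ℝ} {v : Fin n → ℝ}
    (hu : ∑ i, u i ^ 2 = 1) (hv : ∑ j, v j ^ 2 = 1) :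
    c ≤ nuclearNorm (c • Matrix.vecMulVec u v) := by
  refine le_of_eq_of_le ?_ (mInner_le_nuclearNorm _ (spectralNorm_vecMulVec_le_one hu.le hv.le))
  calc c = c * ((∑ i, u i ^ 2) * ∑ j, v j ^ 2) := by rw [hu, hv]; ring
    _ = _ := by
      rw [Finset.sum_mul_sum]
      simp only [mInner, Matrix.smul_apply, Matrix.vecMulVec_apply, smul_eq_mul, Finset.mul_sum]
      exact Finset.sum_congr rfl fun i _ => Finset.sum_congr rfl fun j _ => by ring

theorem IsOptMax.mInner_pos {A X : Matrix (Fin m) (Fin n) ℝ} {θ : ℝ} (hθ : 0 < θ) (hA : A ≠ 0)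
    (hopt : IsOptMax (thetaNorm θ) A X) : 0 < mInner A X := by
  obtain ⟨p, q, hpq⟩ : ∃ p q, A p q ≠ 0 := by
    by_contra! h
    exact hA (Matrix.ext h)
  have hsum : ∀ f : Fin m → Fin n → ℝ, (∀ i j, 0 ≤ f i j) → 0 < f p q →
      0 < ∑ i, ∑ j, f i j := fun f hf hpos =>
    Finset.sum_pos' (fun i _ => Finset.sum_nonneg fun j _ => hf i j)
      ⟨p, Finset.mem_univ p, Finset.sum_pos' (fun j _ => hf p j) ⟨q, Finset.mem_univ q, hpos⟩⟩
  have hl : 0 < l1Norm A := hsum _ (fun _ _ => abs_nonneg _) (abs_pos.2 hpq)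
  have hAA : 0 < mInner A A := hsum _ (fun _ _ => mul_self_nonneg _) (mul_self_pos.2 hpq)
  set c := ((1 + θ) * l1Norm A)⁻¹
  have hc0 : 0 < c := by positivity
  have hl1 : l1Norm (c • A) = c * l1Norm A := by
    simp [l1Norm, abs_mul, abs_of_pos hc0, Finset.mul_sum]
  have hfeas : thetaNorm θ (c • A) ≤ 1 := by
    have h := nuclearNorm_le_l1Norm (c • A)
    have h1 : c * ((1 + θ) * l1Norm A) = 1 := inv_mul_cancel₀ (by positivity)
    rw [thetaNorm, hl1]
    rw [hl1] at h
    linarith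
  have hval : mInner A (c • A) = c * mInner A A := by
    simp only [mInner, Matrix.smul_apply, smul_eq_mul, Finset.mul_sum]
    exact Finset.sum_congr rfl fun i _ => Finset.sum_congr rfl fun j _ => by ring
  exact (mul_pos hc0 hAA).trans_le (hval ▸ hopt.2 _ hfeas)

/-- Optimality of `X`, tested on nonnegative rank-one matrices with a fixed right factor. -/
theorem IsOptMax.rankOne_le {A X : Matrix (Fin m) (Fin n) ℝ} {θ : ℝ} (hθ : 0 < θ)
    (hopt : IsOptMax (thetaNorm θ) A X) {v : Fin n → ℝ} (hv2 : ∑ l, v l ^ 2 = 1)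
    (hv0 : ∀ l, 0 ≤ v l) {w : Fin m → ℝ} (hw0 : ∀ k, 0 ≤ w k) :
    ∑ k, w k * ∑ l, A k l * v l ≤
      mInner A X * ((1 + ∑ k, w k ^ 2) / 2 + θ * ((∑ k, w k) * ∑ l, v l)) := by
  set M := (1 + ∑ k, w k ^ 2) / 2 + θ * ((∑ k, w k) * ∑ l, v l) with hM
  have hq : 0 ≤ ∑ k, w k ^ 2 := Finset.sum_nonneg fun _ _ => sq_nonneg _
  have hM0 : 0 < M := by
    have := mul_nonneg hθ.le (mul_nonneg (Finset.sum_nonneg fun k _ => hw0 k)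
      (Finset.sum_nonneg fun l _ => hv0 l) : 0 ≤ (∑ k, w k) * ∑ l, v l)
    linarith
  have hfeas : thetaNorm θ (M⁻¹ • Matrix.vecMulVec w v) ≤ 1 := by
    have hnuc := nuclearNorm_smul_vecMulVec_le (inv_nonneg.2 hM0.le) w hv2.le
    have hsqrt : √(∑ k, w k ^ 2) ≤ (1 + ∑ k, w k ^ 2) / 2 := by
      nlinarith [Real.sq_sqrt hq, sq_nonneg (√(∑ k, w k ^ 2) - 1)]
    have h := mul_le_mul_of_nonneg_left hsqrt (inv_nonneg.2 hM0.le)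
    have h1 : M⁻¹ * M = 1 := inv_mul_cancel₀ hM0.ne'
    rw [thetaNorm, l1Norm_smul_vecMulVec (inv_nonneg.2 hM0.le) hw0 hv0]
    refine le_of_le_of_eq (b := M⁻¹ * M) ?_ h1
    calc _ ≤ M⁻¹ * ((1 + ∑ k, w k ^ 2) / 2) + θ * (M⁻¹ * ((∑ k, w k) * ∑ l, v l)) := by
          linarith
      _ = M⁻¹ * M := by rw [hM]; ring
  have h := hopt.2 _ hfeas
  rwa [mInner_smul_vecMulVec, inv_mul_le_iff₀ hM0, mul_comm M] at h

/-- First-order optimality inequality for changing one entry of the left factor by `t`. -/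
theorem IsOptMax.update_le {A : Matrix (Fin m) (Fin n) ℝ} {θ σ : ℝ} {u : Fin m → ℝ}
    {v : Fin n → ℝ} (hθ : 0 < θ) (hA : A ≠ 0)
    (hopt : IsOptMax (thetaNorm θ) A (σ • Matrix.vecMulVec u v)) (hσ : 0 < σ)
    (hu2 : ∑ k, u k ^ 2 = 1) (hv2 : ∑ l, v l ^ 2 = 1)
    (hu0 : ∀ k, 0 ≤ u k) (hv0 : ∀ l, 0 ≤ v l) (p : Fin m) {t : ℝ} (ht : 0 ≤ u p + t) :
    t * ∑ l, A p l * v l ≤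
      mInner A (σ • Matrix.vecMulVec u v) * (t * (u p + t / 2 + θ * ∑ l, v l)) := by
  have hpos := hopt.mInner_pos hθ hA
  have hval := mInner_smul_vecMulVec A σ u v
  have hnorm : σ * (1 + θ * ((∑ k, u k) * ∑ l, v l)) ≤ 1 := by
    have h1 := hopt.1
    rw [thetaNorm, l1Norm_smul_vecMulVec hσ.le hu0 hv0] at h1
    have h2 := le_nuclearNorm_smul_vecMulVec σ hu2 hv2
    linarith
  have hw0 : ∀ k, 0 ≤ (u + Pi.single p t : Fin m → ℝ) k := fun k => by
    rcases eq_or_ne k p with rfl | hk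
    · simpa using ht
    · simpa [hk] using hu0 k
  have h := hopt.rankOne_le hθ hv2 hv0 hw0
  have hs1 : ∑ k, (u + Pi.single p t : Fin m → ℝ) k = ∑ k, u k + t := by
    simp [Finset.sum_add_distrib]
  have hs2 : ∑ k, (u + Pi.single p t : Fin m → ℝ) k ^ 2 = 1 + 2 * t * u p + t ^ 2 := by
    simp [add_sq, Finset.sum_add_distrib, hu2, Pi.single_apply, ite_pow]
    ring
  have hs3 : ∑ k, (u + Pi.single p t : Fin m → ℝ) k * ∑ l, A k l * v l =
      ∑ k, u k * ∑ l, A k l * v l + t * ∑ l, A p l * v l := by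
    simp [add_mul, Finset.sum_add_distrib, Pi.single_apply]
  rw [hs1, hs2, hs3] at h
  set lam := mInner A (σ • Matrix.vecMulVec u v)
  set B := ∑ k, u k * ∑ l, A k l * v l
  have hB : lam * (1 + θ * ((∑ k, u k) * ∑ l, v l)) ≤ B := by
    have hB0 : 0 ≤ B := by
      rw [hval] at hpos
      exact (pos_of_mul_pos_right hpos hσ.le).le
    have := mul_le_mul_of_nonneg_right hnorm hB0
    rw [hval]
    linarith
  linarith

theorem stmt15 (A : Matrix (Fin m) (Fin n) ℝ) (hA : A ≠ 0)
    (i j : Fin m) (α : ℝ) (hα : 1 < α)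
    (hdom : ∀ k l : Fin n, α * A j l ≤ A i k)
    (θ : ℝ) (hθ : 1 / (α - 1) < θ)
    (X : Matrix (Fin m) (Fin n) ℝ) (hopt : IsOptMax (thetaNorm θ) A X)
    (σ : ℝ) (u : Fin m → ℝ) (v : Fin n → ℝ) (hσ : 0 < σ)
    (hu2 : (∑ k, u k ^ 2) = 1) (hv2 : (∑ l, v l ^ 2) = 1)
    (hu0 : ∀ k, 0 ≤ u k) (hv0 : ∀ l, 0 ≤ v l)
    (hX : X = σ • Matrix.vecMulVec u v) :
    ∀ l : Fin n, X j l = 0 := by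
  subst hX
  have hα0 : 0 < α - 1 := by linarith
  have hθ0 : 0 < θ := (one_div_pos.2 hα0).trans hθ
  have hθα : 1 < θ * (α - 1) := (div_lt_iff₀ hα0).1 hθ
  have hpos := hopt.mInner_pos hθ0 hA
  have hv1 : ∀ l, v l ≤ 1 := fun l => by
    have := Finset.single_le_sum (f := fun l => v l ^ 2) (fun _ _ => sq_nonneg _)
      (Finset.mem_univ l)
    exact (sq_le_one_iff₀ (hv0 l)).1 (this.trans hv2.le)
  have hui : u i ≤ 1 := by
    have := Finset.single_le_sum (f := fun k => u k ^ 2) (fun _ _ => sq_nonneg _)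
      (Finset.mem_univ i)
    exact (sq_le_one_iff₀ (hu0 i)).1 (this.trans hu2.le)
  have hs : 1 ≤ ∑ l, v l := by
    rw [← hv2]
    exact Finset.sum_le_sum fun l _ => by nlinarith [hv0 l, hv1 l]
  suffices huj : u j = 0 by
    intro l
    simp [Matrix.vecMulVec_apply, huj]
  by_contra hne
  have huj : 0 < u j := (hu0 j).lt_of_ne' hne
  have hdomv : α * ∑ l, A j l * v l ≤ ∑ l, A i l * v l := by
    rw [Finset.mul_sum]
    exact Finset.sum_le_sum fun l _ => by nlinarith [hdom l l, hv0 l]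
  have hj := hopt.update_le hθ0 hA hσ hu2 hv2 hu0 hv0 j (t := -u j) (by simp)
  have hi := hopt.update_le hθ0 hA hσ hu2 hv2 hu0 hv0 i (t := θ * (α - 1) - 1)
    (by linarith [hu0 i])
  set lam := mInner A (σ • Matrix.vecMulVec u v)
  set s := ∑ l, v l
  have hj' : lam * (θ * s) ≤ ∑ l, A j l * v l := by
    have h1 : lam * (u j / 2 + θ * s) ≤ ∑ l, A j l * v l :=
      le_of_mul_le_mul_left (by linarith) huj
    have h2 := mul_pos hpos huj
    linarith
  have hi' : ∑ l, A i l * v l ≤ lam * (u i + (θ * (α - 1) - 1) / 2 + θ * s) :=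
    le_of_mul_le_mul_left (by linarith) (sub_pos.2 hθα)
  have h : lam * (α * (θ * s)) ≤ lam * (u i + (θ * (α - 1) - 1) / 2 + θ * s) := by
    have := mul_le_mul_of_nonneg_left hj' (by linarith : 0 ≤ α)
    linarith
  have h' := le_of_mul_le_mul_left h hpos
  have := mul_le_mul_of_nonneg_left hs (by linarith : 0 ≤ θ * (α - 1))
  linarith

end LAROS
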